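/- Let p be an odd prime. Then there is no finite p-group G with |G'| ≥ p² that has a unique A₂-subgroup K with K ≤ Φ(G). -/

import Mathlib

/-- `G` is a minimal non-abelian group: non-abelian, but all proper subgroups abelian. -/
def IsMinimalNonabelian (G : Type*) [Group G] : Prop :=
  (¬ ∀ a b : G, a * b = b * a) ∧
    ∀ H : Subgroup G, H ≠ ⊤ → ∀ a ∈ H, ∀ b ∈ H, a * b = b * a

/-- `G` is an `𝒜_t`-group: it has a non-abelian subgroup of index `p ^ (t-1)`,
but all subgroups of index `p ^ t` are abelian. -/
def IsAGroup (p t : ℕ) (G : Type*) [Group G] : Prop :=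
  (∃ H : Subgroup G, H.index = p ^ (t - 1) ∧ ¬ ∀ a ∈ H, ∀ b ∈ H, a * b = b * a) ∧
    ∀ H : Subgroup G, H.index = p ^ t → ∀ a ∈ H, ∀ b ∈ H, a * b = b * a



structure MaxIn {G : Type*} [Group G] (p : ℕ) (C B : Subgroup G) : Prop where
  le : C ≤ B
  conj : ∀ b ∈ B, ∀ c ∈ C, b * c * b⁻¹ ∈ C
  pow : ∀ b ∈ B, b ^ p ∈ C
  comm : ∀ a ∈ B, ∀ b ∈ B, a * b * a⁻¹ * b⁻¹ ∈ C
  gen : ∀ b ∈ B, b ∉ C → ∀ e ∈ B, ∃ n : ℤ, ∃ c ∈ C, e = c * b ^ n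
  ne : ∃ b ∈ B, b ∉ C

lemma maxIn_of_relIndex {G : Type*} [Group G] [Finite G] {p : ℕ} [hp : Fact p.Prime]
    (hG : IsPGroup p G) {C B : Subgroup G} (hle : C ≤ B) (hi : C.relIndex B = p) :
    MaxIn p C B := by
  have hB : IsPGroup p B := hG.to_subgroup B
  have hn : (C.subgroupOf B).Normal := by
    apply Subgroup.normal_of_index_eq_minFac_card
    change C.relIndex B = _
    obtain ⟨n, hn⟩ := IsPGroup.iff_card.1 hB
    have hd : C.relIndex B ∣ Nat.card B := Subgroup.index_dvd_card _
    rw [hi, hn] at *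
    have hn0 : n ≠ 0 := by
      rintro rfl
      simp at hd
      exact hp.out.one_lt.ne' hd
    rw [hp.out.pow_minFac hn0]
  have hc : Nat.card (B ⧸ C.subgroupOf B) = p := hi
  have hcyc : IsCyclic (B ⧸ C.subgroupOf B) := isCyclic_of_prime_card hc
  have hcm : ∀ a b : B ⧸ C.subgroupOf B, a * b = b * a := fun a b => by
    let _ := hcyc.commGroup
    exact mul_comm a b
  refine ⟨hle, ?_, ?_, ?_, ?_, ?_⟩
  · intro b hb c hc
    have := hn.conj_mem ⟨c, hle hc⟩ (by simpa [Subgroup.mem_subgroupOf] using hc) ⟨b, hb⟩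
    simpa [Subgroup.mem_subgroupOf] using this
  · intro b hb
    have h1 : ((⟨b, hb⟩ : B) : B ⧸ C.subgroupOf B) ^ p = 1 := by
      conv_lhs => rw [← hc]
      exact pow_card_eq_one'
    rw [← QuotientGroup.mk_pow, QuotientGroup.eq_one_iff] at h1
    simpa [Subgroup.mem_subgroupOf] using h1
  · intro a ha b hb
    have h1 : (((⟨a, ha⟩ : B) * ⟨b, hb⟩ * (⟨a, ha⟩)⁻¹ * (⟨b, hb⟩)⁻¹ : B) :
        B ⧸ C.subgroupOf B) = 1 := by
      simp only [QuotientGroup.mk_mul, QuotientGroup.mk_inv]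
      rw [hcm (QuotientGroup.mk ⟨a, ha⟩)]
      group
    rw [QuotientGroup.eq_one_iff] at h1
    simpa [Subgroup.mem_subgroupOf] using h1
  · intro b hb hbC e he
    have hb1 : ((⟨b, hb⟩ : B) : B ⧸ C.subgroupOf B) ≠ 1 := by
      rw [Ne, QuotientGroup.eq_one_iff]
      simpa [Subgroup.mem_subgroupOf] using hbC
    have := zpowers_eq_top_of_prime_card hc hb1
    have h2 : ((⟨e, he⟩ : B) : B ⧸ C.subgroupOf B) ∈
      Subgroup.zpowers ((⟨b, hb⟩ : B) : B ⧸ C.subgroupOf B) := by rw [this]; trivial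
    obtain ⟨n, hn⟩ := Subgroup.mem_zpowers_iff.1 h2
    refine ⟨n, e * (b ^ n)⁻¹, ?_, by group⟩
    have h3 : (((⟨e, he⟩ : B) * (⟨b, hb⟩ ^ n)⁻¹ : B) : B ⧸ C.subgroupOf B) = 1 := by
      rw [QuotientGroup.mk_mul, QuotientGroup.mk_inv, QuotientGroup.mk_zpow, hn]
      simp
    rw [QuotientGroup.eq_one_iff] at h3
    simpa [Subgroup.mem_subgroupOf] using h3
  · by_contra hcon
    push Not at hcon
    have : C = B := le_antisymm hle hcon
    subst this
    simp at hi
    exact hp.out.one_lt.ne hi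

lemma exists_maxIn {G : Type*} [Group G] [Finite G] {p : ℕ} [hp : Fact p.Prime]
    (hG : IsPGroup p G) {A B : Subgroup G} (hAB : A < B) :
    ∃ C, A ≤ C ∧ C.relIndex B = p ∧ MaxIn p C B := by
  obtain ⟨n, hn⟩ := IsPGroup.iff_card.1 (hG.to_subgroup A)
  obtain ⟨m, hm⟩ := IsPGroup.iff_card.1 (hG.to_subgroup B)
  have hlt : n < m := by
    have : Nat.card A < Nat.card B := by
      refine lt_of_le_of_ne (Subgroup.card_le_of_le hAB.le) ?_
      intro h
      exact hAB.ne (Subgroup.eq_of_le_of_card_ge hAB.le h.ge)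
    rw [hn, hm] at this
    exact (Nat.pow_lt_pow_iff_right hp.out.one_lt).1 this
  obtain ⟨C, hC, hAC⟩ := Sylow.exists_subgroup_card_pow_prime_le (G := B) p (n := n) (m := m - 1)
    (by rw [hm]; exact pow_dvd_pow _ (by omega)) (A.subgroupOf B)
    (by rw [Nat.card_congr (Subgroup.subgroupOfEquivOfLe hAB.le).toEquiv, hn]) (by omega)
  have hi : (C.map B.subtype).relIndex B = p := by
    change ((C.map B.subtype).subgroupOf B).index = p
    rw [← Subgroup.comap_subtype, Subgroup.comap_map_eq_self_of_injective B.subtype_injective]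
    have := C.card_mul_index
    rw [hC, hm] at this
    have h2 : p ^ m = p ^ (m - 1) * p := by rw [← pow_succ]; congr 1; omega
    rw [h2] at this
    exact Nat.eq_of_mul_eq_mul_left (pow_pos hp.out.pos _) this
  have hle : C.map B.subtype ≤ B := Subgroup.map_subtype_le C
  refine ⟨C.map B.subtype, ?_, hi, maxIn_of_relIndex hG hle hi⟩
  intro a ha
  exact ⟨⟨a, hAB.le ha⟩, hAC (by simpa [Subgroup.mem_subgroupOf] using ha), rfl⟩

lemma dvd_of_zpow_mem {G : Type*} [Group G] {p : ℕ} (hp : p.Prime) {C : Subgroup G} {b : G}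
    (hb : b ∉ C) (hbp : b ^ p ∈ C) {i : ℤ} (hi : b ^ i ∈ C) : (p : ℤ) ∣ i := by
  by_contra hnd
  have hco : IsCoprime (p : ℤ) i := (Nat.prime_iff_prime_int.1 hp).coprime_iff_not_dvd.2 hnd
  obtain ⟨u, v, huv⟩ := hco
  apply hb
  have : b = (b ^ p) ^ u * (b ^ i) ^ v := by
    rw [← zpow_natCast, ← zpow_mul, ← zpow_mul, ← zpow_add]
    rw [show (p : ℤ) * u + i * v = 1 by linarith, zpow_one]
  rw [this]
  exact C.mul_mem (C.zpow_mem hbp _) (C.zpow_mem hi _)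

lemma fermat_comm {G : Type*} [Group G] {p : ℕ} [hp : Fact p.Prime]
    (hG : IsPGroup p G) {a e : G} (ha : a ^ p = 1) {i : ℤ} (h : e * a * e⁻¹ = a ^ i) :
    e * a = a * e := by
  have key : ∀ n : ℕ, e ^ n * a * (e ^ n)⁻¹ = a ^ (i ^ n) := by
    intro n
    induction n with
    | zero => simp
    | succ n ih =>
      calc e ^ (n + 1) * a * (e ^ (n + 1))⁻¹ = e * (e ^ n * a * (e ^ n)⁻¹) * e⁻¹ := by
            rw [pow_succ']; group
        _ = (e * a * e⁻¹) ^ (i ^ n) := by rw [ih, conj_zpow]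
        _ = _ := by rw [h, ← zpow_mul, pow_succ']
  obtain ⟨k, hk⟩ := isPGroup_iff_pow_pow_eq_one.1 hG e
  have h1 := key (p ^ k)
  rw [hk] at h1
  simp only [one_mul, inv_one, mul_one] at h1
  have h2 : (p : ℤ) ∣ i ^ (p ^ k) - i := by
    rw [← ZMod.intCast_zmod_eq_zero_iff_dvd]
    push_cast
    rw [ZMod.pow_card_pow, sub_self]
  obtain ⟨c, hc⟩ := h2
  have h3 : a ^ (i ^ (p ^ k)) = a ^ i := by
    rw [show i ^ (p ^ k) = p * c + i by linarith, zpow_add, zpow_mul, zpow_natCast, ha]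
    simp
  rw [h3] at h1
  rw [← h1] at h
  exact mul_inv_eq_iff_eq_mul.1 h

lemma mem_sup_zpowers {G : Type*} [Group G] [Finite G] {H : Subgroup G} {g : G}
    (hg : ∀ h ∈ H, g * h * g⁻¹ ∈ H) {t : G} (ht : t ∈ H ⊔ Subgroup.zpowers g) :
    ∃ h ∈ H, ∃ i : ℤ, t = h * g ^ i := by
  have hgn : ∀ n : ℕ, ∀ h ∈ H, g ^ n * h * (g ^ n)⁻¹ ∈ H := by
    intro n
    induction n with
    | zero => simp
    | succ n ih =>
      intro h hh
      have := hg _ (ih h hh)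
      rw [pow_succ']
      convert this using 1
      group
  have hgz : ∀ n : ℤ, ∀ h ∈ H, g ^ n * h * (g ^ n)⁻¹ ∈ H := by
    intro n h hh
    obtain ⟨m, hm⟩ := (mem_powers_iff_mem_zpowers (x := g) (y := g ^ n)).2 ⟨n, rfl⟩
    simp only at hm
    rw [← hm]
    exact hgn m h hh
  let S : Subgroup G :=
    { carrier := {t | ∃ h ∈ H, ∃ i : ℤ, t = h * g ^ i}
      one_mem' := ⟨1, H.one_mem, 0, by simp⟩
      mul_mem' := by
        rintro _ _ ⟨h, hh, i, rfl⟩ ⟨h', hh', j, rfl⟩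
        refine ⟨h * (g ^ i * h' * (g ^ i)⁻¹), H.mul_mem hh (hgz i _ hh'), i + j, ?_⟩
        rw [zpow_add]; group
      inv_mem' := by
        rintro _ ⟨h, hh, i, rfl⟩
        refine ⟨g ^ (-i) * h⁻¹ * (g ^ (-i))⁻¹, hgz (-i) _ (H.inv_mem hh), -i, ?_⟩
        group }
  have hS : H ⊔ Subgroup.zpowers g ≤ S := by
    refine sup_le (fun h hh => ⟨h, hh, 0, by simp⟩) ?_
    rw [Subgroup.zpowers_le]
    exact ⟨1, H.one_mem, 1, by simp⟩
  exact hS ht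

/-- `(c k)^n = f^(n choose 2) c^n k^n` when `k c = f c k` with `f` central. -/
lemma mul_pow_class_two {G : Type*} [Group G] {c k f : G} (h : k * c = f * c * k)
    (hfc : f * c = c * f) (hfk : f * k = k * f) (n : ℕ) :
    (c * k) ^ n = f ^ (n.choose 2) * c ^ n * k ^ n := by
  have h1 : ∀ n : ℕ, k ^ n * c = f ^ n * c * k ^ n := by
    intro n
    induction n with
    | zero => simp
    | succ n ih =>
      have hfk' : k * f ^ n = f ^ n * k := by
        have : Commute k f := hfk.symm
        exact (this.pow_right n).eq
      calc k ^ (n + 1) * c = k * (k ^ n * c) := by rw [pow_succ']; group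
        _ = k * f ^ n * c * k ^ n := by rw [ih]; group
        _ = f ^ n * (k * c) * k ^ n := by rw [hfk']; group
        _ = f ^ (n + 1) * c * k ^ (n + 1) := by rw [h, pow_succ, pow_succ']; group
  induction n with
  | zero => simp
  | succ n ih =>
    have hc : Commute f c := hfc
    have e1 : c ^ n * f ^ n = f ^ n * c ^ n := ((hc.pow_pow n n).eq).symm
    calc (c * k) ^ (n + 1) = f ^ (n.choose 2) * c ^ n * (k ^ n * c) * k := by
          rw [pow_succ, ih]; group
      _ = f ^ (n.choose 2) * (c ^ n * f ^ n) * c * k ^ n * k := by rw [h1]; group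
      _ = f ^ (n.choose 2) * f ^ n * (c ^ n * c) * (k ^ n * k) := by rw [e1]; group
      _ = _ := by
        rw [← pow_add, ← pow_succ, ← pow_succ, Nat.choose_succ_succ' n 1, Nat.choose_one_right,
          add_comm (n.choose 2) n]

lemma pow_choose_two {G : Type*} [Group G] {p : ℕ} (hodd : Odd p) {f : G} (hf : f ^ p = 1) :
    f ^ (p.choose 2) = 1 := by
  obtain ⟨m, rfl⟩ := hodd
  have : (2 * m + 1).choose 2 = (2 * m + 1) * m := by
    rw [Nat.choose_two_right]
    rw [show 2 * m + 1 - 1 = 2 * m by omega]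
    rw [show (2 * m + 1) * (2 * m) = ((2 * m + 1) * m) * 2 by ring]
    simp
  rw [this, pow_mul, hf, one_pow]


lemma exists_rank_two {G : Type*} [Group G] [Finite G] {p : ℕ} [hp : Fact p.Prime]
    (hodd : Odd p) (hG : IsPGroup p G) :
    ∀ (n : ℕ) (B : Subgroup G), Nat.card B = n → (∀ g, B ≠ Subgroup.zpowers g) →
      ∃ x y : G, x * y = y * x ∧ x ^ p = 1 ∧ y ^ p = 1 ∧
        ∀ i j : ℤ, x ^ i * y ^ j = 1 → (p : ℤ) ∣ i ∧ (p : ℤ) ∣ j := by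
  intro n
  induction n using Nat.strong_induction_on with
  | _ n ih =>
  intro B hBn hB
  by_cases hprop : ∃ C : Subgroup G, C < B ∧ ∀ g, C ≠ Subgroup.zpowers g
  · obtain ⟨C, hCB, hC⟩ := hprop
    refine ih (Nat.card C) ?_ C rfl hC
    rw [← hBn]
    refine lt_of_le_of_ne (Subgroup.card_le_of_le hCB.le) ?_
    intro h
    exact hCB.ne (Subgroup.eq_of_le_of_card_ge hCB.le h.ge)
  push Not at hprop
  have lt_of : ∀ C, MaxIn p C B → C < B := by
    intro C hC
    refine lt_of_le_of_ne hC.le ?_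
    rintro rfl
    obtain ⟨b, hb, hb'⟩ := hC.ne
    exact hb' hb
  have hbot : ⊥ < B := by
    rw [bot_lt_iff_ne_bot]
    intro h
    exact hB 1 (by simpa using h)
  obtain ⟨C, -, -, hC⟩ := exists_maxIn hG hbot
  obtain ⟨a, rfl⟩ := hprop C (lt_of _ hC)
  obtain ⟨b0, hb0, hb0C⟩ := hC.ne
  have hz : Subgroup.zpowers b0 < B := by
    refine lt_of_le_of_ne ?_ (hB b0).symm
    rwa [Subgroup.zpowers_le]
  obtain ⟨C2, hb0C2, -, hC2⟩ := exists_maxIn hG hz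
  obtain ⟨b, rfl⟩ := hprop C2 (lt_of _ hC2)
  have ha : a ∈ B := hC.le (Subgroup.mem_zpowers a)
  have hb : b ∈ B := hC2.le (Subgroup.mem_zpowers b)
  have hbC : b ∉ Subgroup.zpowers a := by
    intro h
    apply hb0C
    have : Subgroup.zpowers b ≤ Subgroup.zpowers a := by rwa [Subgroup.zpowers_le]
    exact this (hb0C2 (Subgroup.mem_zpowers b0))
  have haC2 : a ∉ Subgroup.zpowers b := by
    intro h
    apply hB b
    apply le_antisymm _ (by rwa [Subgroup.zpowers_le])
    intro e he
    obtain ⟨n, c, hc, rfl⟩ := hC.gen b hb hbC e he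
    have : Subgroup.zpowers a ≤ Subgroup.zpowers b := by rwa [Subgroup.zpowers_le]
    exact mul_mem (this hc) (zpow_mem (Subgroup.mem_zpowers b) n)
  have ca : ∀ t ∈ Subgroup.zpowers a, t * a = a * t := by
    rintro t ⟨i, rfl⟩
    exact ((Commute.refl a).zpow_left i).eq
  have cb : ∀ t ∈ Subgroup.zpowers b, t * b = b * t := by
    rintro t ⟨i, rfl⟩
    exact ((Commute.refl b).zpow_left i).eq
  obtain ⟨i, hi⟩ := hC.pow b hb
  simp only at hi
  have hpi : (p : ℤ) ∣ i := by
    apply dvd_of_zpow_mem hp.out haC2 (hC2.pow a ha)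
    rw [hi]
    exact pow_mem (Subgroup.mem_zpowers b) p
  obtain ⟨j, rfl⟩ := hpi
  set c := a ^ (-j) with hcdef
  have hcz : c ∈ Subgroup.zpowers a := ⟨-j, rfl⟩
  have hcB : c ∈ B := hC.le hcz
  set f := b * c * b⁻¹ * c⁻¹ with hf
  have hf1 : f ∈ Subgroup.zpowers a := hC.comm b hb c hcB
  have hf2 : f ∈ Subgroup.zpowers b := hC2.comm b hb c hcB
  have hfc : f * c = c * f := by
    have : Commute f a := ca f hf1
    exact (this.zpow_right _).eq
  have hfb : f * b = b * f := cb f hf2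
  have hbc : b * c = f * c * b := by rw [hf]; group
  -- f ^ p = 1
  have hcpb : c ^ p * b = b * c ^ p := cb _ (hC2.pow c hcB)
  have hfp : f ^ p = 1 := by
    have h1 : (b * c * b⁻¹) ^ p = c ^ p := by
      rw [conj_pow, ← hcpb]; group
    have h2 : b * c * b⁻¹ = f * c := by rw [hf]; group
    have hfc' : Commute f c := hfc
    rw [h2, hfc'.mul_pow] at h1
    exact mul_eq_right.1 h1
  set y := c * b with hy
  have hyp : y ^ p = 1 := by
    rw [hy, mul_pow_class_two hbc hfc hfb, pow_choose_two hodd hfp, one_mul, ← hi, hcdef,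
      ← zpow_natCast, ← zpow_mul, ← zpow_add]
    simp [mul_comm]
  have hyC : y ∉ Subgroup.zpowers a := by
    intro h
    exact hbC ((Subgroup.mul_mem_cancel_left _ hcz).1 h)
  have ha1 : a ≠ 1 := by
    rintro rfl
    apply haC2
    exact one_mem _
  -- x
  obtain ⟨m, hm⟩ := (IsPGroup.iff_orderOf.1 hG) a
  have hm0 : m ≠ 0 := by
    rintro rfl
    rw [pow_zero, orderOf_eq_one_iff] at hm
    exact ha1 hm
  obtain ⟨m, rfl⟩ := Nat.exists_eq_succ_of_ne_zero hm0
  set x := a ^ (p ^ m) with hx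
  have hxp : x ^ p = 1 := by
    rw [hx, ← pow_mul, ← pow_succ, ← Nat.succ_eq_add_one, ← hm]
    exact pow_orderOf_eq_one a
  have hx1 : x ≠ 1 := by
    intro h
    have := orderOf_dvd_of_pow_eq_one h
    rw [hm] at this
    have := (Nat.pow_dvd_pow_iff_le_right hp.out.one_lt).1 this
    omega
  have hyB : y ∈ B := mul_mem hcB hb
  have hyx : y * x = x * y := by
    obtain ⟨l, hl⟩ := hC.conj y hyB a (Subgroup.mem_zpowers a)
    simp only at hl
    apply fermat_comm hG hxp (i := l)
    rw [hx, ← conj_pow, ← hl, ← zpow_natCast, ← zpow_natCast, ← zpow_mul, ← zpow_mul, mul_comm]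
  refine ⟨x, y, hyx.symm, hxp, hyp, ?_⟩
  intro i j hij
  have hj : (p : ℤ) ∣ j := by
    apply dvd_of_zpow_mem hp.out hyC (by rw [hyp]; exact one_mem _)
    rw [← inv_eq_of_mul_eq_one_right hij]
    exact inv_mem (zpow_mem (pow_mem (Subgroup.mem_zpowers a) _) _)
  refine ⟨?_, hj⟩
  obtain ⟨l, rfl⟩ := hj
  rw [zpow_mul, zpow_natCast, hyp, one_zpow, mul_one] at hij
  exact dvd_of_zpow_mem hp.out (C := ⊥) (by simpa using hx1) (by simpa using hxp) (by simpa using hij)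

/-- Subgroups not containing `K` are abelian or minimal nonabelian. -/
def MinStar {G : Type*} [Group G] (K : Subgroup G) : Prop :=
  ∀ S : Subgroup G, ¬ K ≤ S → ∀ a ∈ S, ∀ b ∈ S, a * b ≠ b * a →
    ∀ T : Subgroup G, T ≤ S → a ∈ T → b ∈ T → S ≤ T

lemma inf_sup_zpowers {G : Type*} [Group G] [Finite G] {p : ℕ} (hp : p.Prime)
    {H K : Subgroup G} (hHK : H ≤ K) {g : G} (hg : ∀ h ∈ H, g * h * g⁻¹ ∈ H)
    (hgK : g ∉ K) (hgp : g ^ p ∈ H) {t : G} (ht : t ∈ H ⊔ Subgroup.zpowers g) (htK : t ∈ K) :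
    t ∈ H := by
  obtain ⟨h, hh, i, rfl⟩ := mem_sup_zpowers hg ht
  have h1 : g ^ i ∈ K := (K.mul_mem_cancel_left (hHK hh)).1 htK
  obtain ⟨j, rfl⟩ := dvd_of_zpow_mem hp hgK (hHK hgp) h1
  rw [zpow_mul, zpow_natCast]
  exact mul_mem hh (zpow_mem hgp j)

lemma not_le_sup_zpowers {G : Type*} [Group G] [Finite G] {p : ℕ} (hp : p.Prime)
    {H K : Subgroup G} (hHK : H ≤ K) {g : G} (hg : ∀ h ∈ H, g * h * g⁻¹ ∈ H)
    (hgK : g ∉ K) (hgp : g ^ p ∈ H) (hne : ∃ k ∈ K, k ∉ H) :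
    ¬ K ≤ H ⊔ Subgroup.zpowers g := by
  intro h
  obtain ⟨k, hk, hkH⟩ := hne
  exact hkH (inf_sup_zpowers hp hHK hg hgK hgp (h hk) hk)

lemma comm_props {G : Type*} [Group G] [Finite G] {p : ℕ} [hp : Fact p.Prime]
    (hG : IsPGroup p G) {H : Subgroup G} (hab : ∀ a ∈ H, ∀ b ∈ H, a * b = b * a) {g : G}
    (hg : ∀ h ∈ H, g * h * g⁻¹ ∈ H)
    (hT : ∀ a ∈ H ⊔ Subgroup.zpowers g, ∀ b ∈ H ⊔ Subgroup.zpowers g, a * b ≠ b * a →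
      ∀ T : Subgroup G, T ≤ H ⊔ Subgroup.zpowers g → a ∈ T → b ∈ T →
        H ⊔ Subgroup.zpowers g ≤ T) :
    ∀ h ∈ H, (h * g * h⁻¹ * g⁻¹) ^ p = 1 ∧
      ∀ e : G, (∀ h ∈ H, e * h * e⁻¹ ∈ H) → e * g * e⁻¹ * g⁻¹ ∈ H →
        e * (h * g * h⁻¹ * g⁻¹) = (h * g * h⁻¹ * g⁻¹) * e := by
  have hmem : ∀ h ∈ H, h * g * h⁻¹ * g⁻¹ ∈ H := by
    intro h hh
    have := mul_mem hh (hg _ (inv_mem hh))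
    convert this using 1
    group
  -- homomorphism property
  have hmul : ∀ h ∈ H, ∀ h' ∈ H, (h * h') * g * (h * h')⁻¹ * g⁻¹ =
      (h * g * h⁻¹ * g⁻¹) * (h' * g * h'⁻¹ * g⁻¹) := by
    intro h hh h' hh'
    have e1 := hab h hh _ (hmem h' hh')
    calc (h * h') * g * (h * h')⁻¹ * g⁻¹ = (h * (h' * g * h'⁻¹ * g⁻¹)) * (g * h⁻¹ * g⁻¹) := by group
      _ = (h' * g * h'⁻¹ * g⁻¹) * (h * g * h⁻¹ * g⁻¹) := by rw [e1]; group
      _ = _ := hab _ (hmem _ hh') _ (hmem _ hh)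
  have hpw : ∀ h ∈ H, ∀ n : ℕ, h ^ n * g * (h ^ n)⁻¹ * g⁻¹ = (h * g * h⁻¹ * g⁻¹) ^ n := by
    intro h hh n
    induction n with
    | zero => simp
    | succ n ih => rw [pow_succ, hmul _ (pow_mem hh n) _ hh, ih, pow_succ]
  have key : ∃ h0 ∈ H, (h0 * g * h0⁻¹ * g⁻¹) ^ p = 1 ∧
      ∀ h ∈ H, ∃ i : ℕ, h * g * h⁻¹ * g⁻¹ = (h0 * g * h0⁻¹ * g⁻¹) ^ i := by
    by_cases hc : ∀ h ∈ H, h * g = g * h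
    · refine ⟨1, one_mem _, by simp, ?_⟩
      intro h hh
      refine ⟨0, ?_⟩
      rw [hc h hh]
      group
    push Not at hc
    obtain ⟨h1, hh1, hne⟩ := hc
    have hlt : Subgroup.zpowers g < H ⊔ Subgroup.zpowers g := by
      refine lt_of_le_of_ne le_sup_right ?_
      intro heq
      have : h1 ∈ Subgroup.zpowers g := by rw [heq]; exact (le_sup_left : H ≤ _) hh1
      obtain ⟨i, rfl⟩ := this
      exact hne ((Commute.refl g).zpow_left i).eq
    obtain ⟨C, hgC, -, hC⟩ := exists_maxIn hG hlt
    have hgC' : g ∈ C := hgC (Subgroup.mem_zpowers g)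
    have hCab : ∀ a ∈ C, ∀ b ∈ C, a * b = b * a := by
      intro a ha b hb
      by_contra hcon
      have := hT a (hC.le ha) b (hC.le hb) hcon C hC.le ha hb
      obtain ⟨t, ht, ht'⟩ := hC.ne
      exact ht' (this ht)
    have hHT : H ≤ H ⊔ Subgroup.zpowers g := le_sup_left
    have h1C : h1 ∉ C := fun h => hne (hCab _ h _ hgC')
    have triv : ∀ c ∈ C, c * g * c⁻¹ * g⁻¹ = 1 := by
      intro c hc
      rw [hCab c hc g hgC']; group
    refine ⟨h1, hh1, ?_, ?_⟩
    · rw [← hpw h1 hh1]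
      exact triv _ (hC.pow _ (hHT hh1))
    · intro h hh
      obtain ⟨n, c, hc, hn⟩ := hC.gen h1 (hHT hh1) h1C h (hHT hh)
      obtain ⟨m, hm⟩ := (mem_powers_iff_mem_zpowers (x := h1) (y := h1 ^ n)).2 ⟨n, rfl⟩
      simp only at hm
      rw [← hm] at hn
      have hcH : c ∈ H := by
        rw [← H.mul_mem_cancel_right (pow_mem hh1 m), ← hn]
        exact hh
      refine ⟨m, ?_⟩
      rw [hn, hmul c hcH _ (pow_mem hh1 m), triv c hc, one_mul, hpw h1 hh1]
  obtain ⟨h0, hh0, h0p, hgen⟩ := key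
  intro h hh
  obtain ⟨i, hi⟩ := hgen h hh
  rw [hi]
  constructor
  · rw [← pow_mul, mul_comm, pow_mul, h0p, one_pow]
  · intro e he heg
    have hc0 : e * (h0 * g * h0⁻¹ * g⁻¹) = (h0 * g * h0⁻¹ * g⁻¹) * e := by
      obtain ⟨l, hl⟩ := hgen _ (he h0 hh0)
      apply fermat_comm hG h0p (i := l)
      rw [zpow_natCast, ← hl]
      set h2 := e * h0 * e⁻¹ with hh2
      have hh2' : h2 ∈ H := he h0 hh0
      set w := e * g * e⁻¹ * g⁻¹ with hw
      have e1 := hab h2 hh2' w heg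
      have e2 := hab w heg _ (hmem h2 hh2')
      calc e * (h0 * g * h0⁻¹ * g⁻¹) * e⁻¹ = (h2 * w) * g * h2⁻¹ * g⁻¹ * w⁻¹ := by
            rw [hh2, hw]; group
        _ = w * (h2 * g * h2⁻¹ * g⁻¹) * w⁻¹ := by rw [e1]; group
        _ = _ := by rw [e2]; group
    have : Commute e (h0 * g * h0⁻¹ * g⁻¹) := hc0
    exact (this.pow_right i).eq


lemma pow_central {G : Type*} [Group G] [Finite G] {p : ℕ} [hp : Fact p.Prime]
    (hodd : Odd p) (hG : IsPGroup p G) {K M : Subgroup G} (hK : K.Normal) (hstar : MinStar K)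
    (hM : MaxIn p M K) (hMn : ∃ a ∈ M, ∃ b ∈ M, a * b ≠ b * a)
    {y : G} (hyK : y ∉ K) (hyp : y ^ p ∈ K) : ∀ k ∈ K, k * y ^ p = y ^ p * k := by
  obtain ⟨a0, ha0, b0, hb0, hab0⟩ := hMn
  set E := K ⊔ Subgroup.zpowers y with hE
  have hKE : K ≤ E := le_sup_left
  have hyE : y ∈ E := (le_sup_right : _ ≤ E) (Subgroup.mem_zpowers y)
  have hlt : Subgroup.zpowers y < E := by
    refine lt_of_le_of_ne le_sup_right ?_
    intro heq
    apply hab0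
    have h1 : a0 ∈ Subgroup.zpowers y := by rw [heq]; exact hKE (hM.le ha0)
    have h2 : b0 ∈ Subgroup.zpowers y := by rw [heq]; exact hKE (hM.le hb0)
    obtain ⟨i, rfl⟩ := h1
    obtain ⟨j, rfl⟩ := h2
    exact ((Commute.refl y).zpow_zpow i j).eq
  obtain ⟨S, hyS', -, hS⟩ := exists_maxIn hG hlt
  have hyS : y ∈ S := hyS' (Subgroup.mem_zpowers y)
  have hKS : ¬ K ≤ S := by
    intro h
    obtain ⟨e, he, he'⟩ := hS.ne
    exact he' ((sup_le h hyS' : E ≤ S) he)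
  set H := S ⊓ K with hH
  have hHK : H ≤ K := inf_le_right
  have hHS : H ≤ S := inf_le_left
  have hneK : ∃ k ∈ K, k ∉ H := by
    obtain ⟨k, hk, hk'⟩ := SetLike.not_le_iff_exists.1 hKS
    exact ⟨k, hk, fun h => hk' (hHS h)⟩
  have hconjE : ∀ e ∈ E, ∀ h ∈ H, e * h * e⁻¹ ∈ H := fun e he h hh =>
    ⟨hS.conj e he h (hHS hh), hK.conj_mem h (hHK hh) e⟩
  have hgenH : ∀ k ∈ K, k ∉ H → ∀ k' ∈ K, ∃ n : ℤ, ∃ h ∈ H, k' = h * k ^ n := by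
    intro k hk hkH k' hk'
    obtain ⟨n, c, hc, hn⟩ := hS.gen k (hKE hk) (fun h => hkH ⟨h, hk⟩) k' (hKE hk')
    refine ⟨n, c, Subgroup.mem_inf.2 ⟨hc, ?_⟩, hn⟩
    rw [← K.mul_mem_cancel_right (zpow_mem hk n), ← hn]
    exact hk'
  have hypH : y ^ p ∈ H := ⟨pow_mem hyS p, hyp⟩
  have hHab : ∀ a ∈ H, ∀ b ∈ H, a * b = b * a := by
    intro a ha b hb
    by_contra hcon
    exact hyK (hHK (hstar S hKS a (hHS ha) b (hHS hb) hcon H hHS ha hb hyS))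
  -- commutators with K and y land in H
  have hcommK : ∀ k ∈ K, ∀ e ∈ E, e * k * e⁻¹ * k⁻¹ ∈ H := by
    intro k hk e he
    exact Subgroup.mem_inf.2 ⟨hS.comm e he k (hKE hk), mul_mem (hK.conj_mem k hk e) (inv_mem hk)⟩
  have hgK : ∀ v ∈ K, y * v ∉ K := fun v hv h => hyK ((K.mul_mem_cancel_right hv).1 h)
  have hyvp : ∀ v ∈ K, (y * v) ^ p ∈ H := by
    intro v hv
    refine Subgroup.mem_inf.2 ⟨hS.pow _ (mul_mem hyE (hKE hv)), ?_⟩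
    rw [← QuotientGroup.eq_one_iff] at hyp hv ⊢
    rw [QuotientGroup.mk_pow] at hyp ⊢
    rw [QuotientGroup.mk_mul, hv, mul_one, hyp]
  have props : ∀ v ∈ K, ∀ h ∈ H, (h * (y * v) * h⁻¹ * (y * v)⁻¹) ^ p = 1 ∧
      ∀ e ∈ E, e * (h * (y * v) * h⁻¹ * (y * v)⁻¹) = (h * (y * v) * h⁻¹ * (y * v)⁻¹) * e := by
    intro v hv h hh
    have hyvE : y * v ∈ E := mul_mem hyE (hKE hv)
    obtain ⟨h1, h2⟩ := comm_props hG hHab (g := y * v) (hconjE _ hyvE)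
      (hstar _ (not_le_sup_zpowers hp.out hHK (hconjE _ hyvE) (hgK v hv) (hyvp v hv) hneK)) h hh
    refine ⟨h1, fun e he => h2 e (hconjE e he) ?_⟩
    obtain ⟨k, hk, i, rfl⟩ := mem_sup_zpowers (H := K) (g := y) (fun h hh => hK.conj_mem h hh y) he
    refine Subgroup.mem_inf.2 ⟨hS.comm _ he _ hyvE, ?_⟩
    rw [← QuotientGroup.eq_one_iff] at hv hk ⊢
    simp only [QuotientGroup.mk_mul, QuotientGroup.mk_inv, QuotientGroup.mk_zpow, hv, hk]
    group
  have propy : ∀ h ∈ H, (h * y * h⁻¹ * y⁻¹) ^ p = 1 ∧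
      ∀ e ∈ E, e * (h * y * h⁻¹ * y⁻¹) = (h * y * h⁻¹ * y⁻¹) * e := by
    intro h hh
    have := props 1 (one_mem _) h hh
    simpa using this
  have hcm : ∀ h ∈ H, ∀ g ∈ E, h * g * h⁻¹ * g⁻¹ ∈ H := by
    intro h hh g hg
    have := mul_mem hh (hconjE g hg _ (inv_mem hh))
    convert this using 1
    group
  have propk : ∀ h ∈ H, ∀ k ∈ K, (h * k * h⁻¹ * k⁻¹) ^ p = 1 ∧
      ∀ e ∈ E, e * (h * k * h⁻¹ * k⁻¹) = (h * k * h⁻¹ * k⁻¹) * e := by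
    intro h hh k hk
    obtain ⟨a1, a2⟩ := propy h hh
    obtain ⟨b1, b2⟩ := props k hk h hh
    set u := h * y * h⁻¹ * y⁻¹ with hu
    set w := h * (y * k) * h⁻¹ * (y * k)⁻¹ with hw
    have huw : y * (h * k * h⁻¹ * k⁻¹) * y⁻¹ = u⁻¹ * w := by rw [hu, hw]; group
    have huwc : ∀ e ∈ E, e * (u⁻¹ * w) = (u⁻¹ * w) * e := by
      intro e he
      have c1 : Commute e u := a2 e he
      have c2 : Commute e w := b2 e he
      exact (c1.inv_right.mul_right c2).eq
    have heq : h * k * h⁻¹ * k⁻¹ = u⁻¹ * w := by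
      have h1 := huwc y hyE
      rw [← huw] at h1
      rw [← huw]
      have h2 : y * (y * (h * k * h⁻¹ * k⁻¹) * y⁻¹) = y * (h * k * h⁻¹ * k⁻¹) := by
        rw [h1]; group
      exact (mul_left_cancel h2).symm
    rw [heq]
    refine ⟨?_, huwc⟩
    have c3 : Commute u⁻¹ w := by
      have hwE : w ∈ E := hKE (hHK (hcm h hh _ (mul_mem hyE (hKE hk))))
      have : Commute w u := a2 w hwE
      exact this.symm.inv_left
    rw [c3.mul_pow, inv_pow, a1, b1]
    simp
  -- p-th powers of K are central in K
  have hpowc : ∀ k' ∈ K, ∀ k ∈ K, k' ^ p * k = k * k' ^ p := by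
    intro k' hk' k hk
    have hpH : k' ^ p ∈ H := ⟨hS.pow _ (hKE hk'), pow_mem hk' p⟩
    by_cases hkH : k' ∈ H
    · obtain ⟨a1, a2⟩ := propk k' hkH k hk
      set u := k' * k * k'⁻¹ * k⁻¹ with hu
      have h1 : k * k' * k⁻¹ = u⁻¹ * k' := by rw [hu]; group
      have c1 : Commute u⁻¹ k' := by
        have : Commute k' u := a2 k' (hKE hk')
        exact this.symm.inv_left
      have h2 : (k * k' * k⁻¹) ^ p = k' ^ p := by
        rw [h1, c1.mul_pow, inv_pow, a1]; simp
      rw [conj_pow] at h2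
      exact (mul_inv_eq_iff_eq_mul.1 h2).symm
    · obtain ⟨n, h, hh, rfl⟩ := hgenH k' hk' hkH k hk
      have c1 : Commute (k' ^ p) h := hHab _ hpH _ hh
      have c2 : Commute (k' ^ p) (k' ^ n) := ((Commute.refl k').pow_left p).zpow_right n
      exact (c1.mul_right c2).eq
  -- Q
  set Q := Subgroup.closure {t | ∃ k ∈ K, t = k ^ p} with hQ
  have hQmem : ∀ k ∈ K, k ^ p ∈ Q := fun k hk => Subgroup.subset_closure ⟨k, hk, rfl⟩
  have hQH : Q ≤ H := by
    rw [hQ, Subgroup.closure_le]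
    rintro _ ⟨k, hk, rfl⟩
    exact ⟨hS.pow _ (hKE hk), pow_mem hk p⟩
  have hQM : Q ≤ M := by
    rw [hQ, Subgroup.closure_le]
    rintro _ ⟨k, hk, rfl⟩
    exact hM.pow _ hk
  have hQc : ∀ q ∈ Q, ∀ k ∈ K, q * k = k * q := by
    intro q hq k hk
    have : Q ≤ Subgroup.centralizer {k} := by
      rw [hQ, Subgroup.closure_le]
      rintro _ ⟨k', hk', rfl⟩
      rw [SetLike.mem_coe, Subgroup.mem_centralizer_singleton_iff]
      exact hpowc k' hk' k hk
    exact (Subgroup.mem_centralizer_singleton_iff.1 (this hq))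
  have hQy : ∀ q ∈ Q, y * q * y⁻¹ ∈ Q := by
    intro q hq
    have : Q ≤ Q.comap (MulAut.conj y).toMonoidHom := by
      conv_lhs => rw [hQ]
      rw [Subgroup.closure_le]
      rintro _ ⟨k', hk', rfl⟩
      change y * k' ^ p * y⁻¹ ∈ Q
      rw [← conj_pow]
      exact hQmem _ (hK.conj_mem _ hk' y)
    exact this hq
  have hyQ : ∀ k ∈ K, y * k ^ p = k ^ p * y := by
    intro k hk
    by_contra hcon
    have hyT : y ∈ H ⊔ Subgroup.zpowers y :=
      (le_sup_right : _ ≤ H ⊔ Subgroup.zpowers y) (Subgroup.mem_zpowers y)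
    have hyT0 : y ∈ Q ⊔ Subgroup.zpowers y :=
      (le_sup_right : _ ≤ Q ⊔ Subgroup.zpowers y) (Subgroup.mem_zpowers y)
    have hTT := hstar (H ⊔ Subgroup.zpowers y)
      (not_le_sup_zpowers hp.out hHK (hconjE _ hyE) hyK hypH hneK) y hyT (k ^ p)
      ((le_sup_left : H ≤ _) (hQH (hQmem k hk))) hcon (Q ⊔ Subgroup.zpowers y)
      (sup_le_sup_right hQH _) hyT0 ((le_sup_left : Q ≤ _) (hQmem k hk))
    have hHform : ∀ h ∈ H, ∃ q ∈ Q, ∃ j : ℤ, h = q * (y ^ p) ^ j := by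
      intro h hh
      obtain ⟨q, hq, i, rfl⟩ := mem_sup_zpowers hQy (hTT ((le_sup_left : H ≤ _) hh))
      have h1 : y ^ i ∈ K := (K.mul_mem_cancel_left (hHK (hQH hq))).1 (hHK hh)
      obtain ⟨j, rfl⟩ := dvd_of_zpow_mem hp.out hyK hyp h1
      exact ⟨q, hq, j, by rw [zpow_mul, zpow_natCast]⟩
    apply hab0
    by_cases hypM : y ^ p ∈ M
    · have hHM : H ≤ M := by
        intro h hh
        obtain ⟨q, hq, j, rfl⟩ := hHform h hh
        exact mul_mem (hQM hq) (zpow_mem hypM j)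
      have hMH : M ≤ H := by
        intro m hm
        by_contra hmH
        obtain ⟨b, hb, hbM⟩ := hM.ne
        obtain ⟨n, h, hh, rfl⟩ := hgenH m (hM.le hm) hmH b hb
        exact hbM (mul_mem (hHM hh) (zpow_mem hm n))
      exact hHab _ (hMH ha0) _ (hMH hb0)
    · obtain ⟨k1, hk1, hk1H⟩ := hneK
      obtain ⟨n, m, hm, hn⟩ := hM.gen (y ^ p) hyp hypM k1 hk1
      have hmH : m ∉ H := by
        intro h
        apply hk1H
        rw [hn]
        exact mul_mem h (zpow_mem hypH n)
      have hMform : ∀ t ∈ M, ∃ q ∈ Q, ∃ j : ℤ, t = q * m ^ j := by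
        intro t ht
        obtain ⟨j, h, hh, rfl⟩ := hgenH m (hM.le hm) hmH t (hM.le ht)
        have hhM : h ∈ M := (M.mul_mem_cancel_right (zpow_mem hm j)).1 ht
        obtain ⟨q, hq, l, rfl⟩ := hHform h hh
        have h1 : (y ^ p) ^ l ∈ M := (M.mul_mem_cancel_left (hQM hq)).1 hhM
        obtain ⟨l', rfl⟩ := dvd_of_zpow_mem hp.out hypM (hM.pow _ hyp) h1
        refine ⟨q * (y ^ p) ^ ((p : ℤ) * l'), mul_mem hq ?_, j, rfl⟩
        rw [zpow_mul, zpow_natCast]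
        exact zpow_mem (hQmem _ hyp) _
      obtain ⟨q, hq, i, rfl⟩ := hMform a0 ha0
      obtain ⟨q', hq', j, rfl⟩ := hMform b0 hb0
      have hmK := hM.le hm
      have c1 : Commute q q' := hQc _ hq _ (hHK (hQH hq'))
      have c2 : Commute q (m ^ j) := hQc _ hq _ (zpow_mem hmK j)
      have c3 : Commute (m ^ i) q' := (hQc _ hq' _ (zpow_mem hmK i)).symm
      have c4 : Commute (m ^ i) (m ^ j) := (Commute.refl m).zpow_zpow i j
      exact ((c1.mul_right c2).mul_left (c3.mul_right c4)).eq
  -- final computation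
  intro k hk
  set c := y * k * y⁻¹ * k⁻¹ with hc
  have hcH : c ∈ H := hcommK k hk y hyE
  obtain ⟨d1, d2⟩ := propy c hcH
  set d' := c * y * c⁻¹ * y⁻¹ with hd'
  obtain ⟨f1, f2⟩ := propk c hcH k hk
  set f' := c * k * c⁻¹ * k⁻¹ with hf'
  have hcE : c ∈ E := hKE (hHK hcH)
  have cf : Commute f'⁻¹ c := by
    have : Commute c f' := f2 c hcE
    exact this.symm.inv_left
  have cfk : Commute f'⁻¹ k := by
    have : Commute k f' := f2 k (hKE hk)
    exact this.symm.inv_left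
  have hcp : c ^ p = 1 := by
    have h1 : y * k * y⁻¹ = c * k := by rw [hc]; group
    have h2 : (y * k * y⁻¹) ^ p = k ^ p := by
      rw [conj_pow, hyQ k hk]; group
    rw [h1, mul_pow_class_two (f := f'⁻¹) (by rw [hf']; group) cf.eq cfk.eq,
      pow_choose_two hodd (by rw [inv_pow, f1, inv_one]), one_mul] at h2
    exact mul_eq_right.1 h2
  have cd : Commute d'⁻¹ c := by
    have : Commute c d' := d2 c hcE
    exact this.symm.inv_left
  have cdy : Commute y d'⁻¹ := by
    have : Commute y d' := d2 y hyE
    exact this.inv_right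
  have hyc : y * c * y⁻¹ = d'⁻¹ * c := by rw [hd']; group
  have hyk : y * k * y⁻¹ = c * k := by rw [hc]; group
  have hform : ∀ n : ℕ, y ^ n * k * (y ^ n)⁻¹ = d'⁻¹ ^ (n.choose 2) * c ^ n * k := by
    intro n
    induction n with
    | zero => simp
    | succ n ih =>
      have e0 : y * d'⁻¹ ^ (n.choose 2) * y⁻¹ = d'⁻¹ ^ (n.choose 2) := by
        rw [(cdy.pow_right _).eq]; group
      have e1 : y * c ^ n * y⁻¹ = d'⁻¹ ^ n * c ^ n := by
        rw [← conj_pow, hyc, cd.mul_pow]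
      calc y ^ (n + 1) * k * (y ^ (n + 1))⁻¹ = y * (y ^ n * k * (y ^ n)⁻¹) * y⁻¹ := by
            rw [pow_succ']; group
        _ = (y * d'⁻¹ ^ (n.choose 2) * y⁻¹) * (y * c ^ n * y⁻¹) * (y * k * y⁻¹) := by
            rw [ih]; group
        _ = d'⁻¹ ^ (n.choose 2) * d'⁻¹ ^ n * (c ^ n * c) * k := by
            rw [e0, e1, hyk]; simp only [mul_assoc]
        _ = _ := by
            rw [← pow_add, ← pow_succ, Nat.choose_succ_succ' n 1, Nat.choose_one_right,
              add_comm (n.choose 2) n]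
  have := hform p
  rw [hcp, pow_choose_two hodd (by rw [inv_pow, d1, inv_one]), one_mul, one_mul] at this
  exact (mul_inv_eq_iff_eq_mul.1 this).symm


lemma abel_of_gen {G : Type*} [Group G] {p : ℕ} {N K : Subgroup G} (hN : MaxIn p N K)
    (hab : ∀ a ∈ N, ∀ b ∈ N, a * b = b * a) {k : G} (hk : k ∈ K) (hkN : k ∉ N)
    (hc : ∀ n ∈ N, n * k = k * n) : ∀ a ∈ K, ∀ b ∈ K, a * b = b * a := by
  intro a ha b hb
  obtain ⟨i, q, hq, rfl⟩ := hN.gen k hk hkN a ha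
  obtain ⟨j, q', hq', rfl⟩ := hN.gen k hk hkN b hb
  have c1 : Commute q q' := hab _ hq _ hq'
  have c2 : Commute q (k ^ j) := Commute.zpow_right (hc q hq) j
  have c3 : Commute (k ^ i) q' := (Commute.zpow_right (hc q' hq') i).symm
  have c4 : Commute (k ^ i) (k ^ j) := (Commute.refl k).zpow_zpow i j
  exact ((c1.mul_right c2).mul_left (c3.mul_right c4)).eq

lemma exists_N {G : Type*} [Group G] [Finite G] {p : ℕ} [hp : Fact p.Prime]
    (hG : IsPGroup p G) {K : Subgroup G} (hK : K.Normal) (hne : K ≠ ⊥) :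
    ∃ N : Subgroup G, MaxIn p N K ∧ (∀ k ∈ K, ∀ g, g * k * g⁻¹ * k⁻¹ ∈ N) := by
  have hle : ⁅K, (⊤ : Subgroup G)⁆ ≤ K := Subgroup.commutator_le_left K ⊤
  have hlt : ⁅K, (⊤ : Subgroup G)⁆ < K := by
    refine lt_of_le_of_ne hle fun heq => hne ?_
    have hnil : Group.IsNilpotent G := hG.isNilpotent
    obtain ⟨n, hn⟩ := Subgroup.nilpotent_iff_lowerCentralSeries.1 hnil
    have : ∀ m, K ≤ (⊤ : Subgroup G).lowerCentralSeries m := by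
      intro m
      induction m with
      | zero => simp
      | succ m ih =>
        rw [← heq]
        exact Subgroup.commutator_mono ih le_top
    exact le_bot_iff.1 (hn ▸ this n)
  obtain ⟨N, h1, -, h2⟩ := exists_maxIn hG hlt
  refine ⟨N, h2, fun k hk g => h1 ?_⟩
  have := Subgroup.commutator_mem_commutator hk (Subgroup.mem_top g)
  have := inv_mem this
  rwa [commutatorElement_inv] at this

lemma exists_w {G : Type*} [Group G] [Finite G] {p : ℕ} [hp : Fact p.Prime]
    (hodd : Odd p) {K N : Subgroup G} (hK : K.Normal) (hN : MaxIn p N K)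
    (hc : ∀ k ∈ K, ∀ g, g * k * g⁻¹ * k⁻¹ ∈ N) (hNn : N.Normal)
    {x y : G} (hx : x ^ p ∈ K) (hy : y ^ p ∈ K) (hxy : x * y * x⁻¹ * y⁻¹ ∈ K)
    (hind : ∀ i j : ℤ, x ^ i * y ^ j ∈ K → (p : ℤ) ∣ i ∧ (p : ℤ) ∣ j) :
    ∃ w, w ∉ K ∧ w ^ p ∈ N := by
  have hp1 : ¬ (p : ℤ) ∣ 1 := by
    intro h
    have := Int.natCast_dvd_natCast.1 (by simpa using h : (p : ℤ) ∣ ((1 : ℕ) : ℤ))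
    exact hp.out.one_lt.ne' (Nat.dvd_one.1 this)
  by_cases hxN : x ^ p ∈ N
  · refine ⟨x, fun h => hp1 (hind 1 0 (by simpa using h)).1, hxN⟩
  obtain ⟨n, c, hcN, hn⟩ := hN.gen _ hx hxN _ hy
  have hcom : Commute (x : G ⧸ K) (y : G ⧸ K) := by
    rw [← QuotientGroup.eq_one_iff] at hxy
    simp only [QuotientGroup.mk_mul, QuotientGroup.mk_inv] at hxy
    exact mul_inv_eq_iff_eq_mul.1 (mul_inv_eq_one.1 hxy)
  have hf : x ^ (-n) * y * (x ^ (-n))⁻¹ * y⁻¹ ∈ K := by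
    rw [← QuotientGroup.eq_one_iff]
    simp only [QuotientGroup.mk_mul, QuotientGroup.mk_inv, QuotientGroup.mk_zpow]
    rw [(hcom.zpow_left (-n)).eq]
    group
  refine ⟨y * x ^ (-n), ?_, ?_⟩
  · intro h
    have : x ^ (-n) * y ^ (1 : ℤ) ∈ K := by
      rw [zpow_one]
      exact (hK.mem_comm h)
    exact hp1 (hind _ _ this).2
  · set f := x ^ (-n) * y * (x ^ (-n))⁻¹ * y⁻¹ with hfd
    have hfc : ∀ g : G, (f : G ⧸ N) * (g : G ⧸ N) = (g : G ⧸ N) * (f : G ⧸ N) := by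
      intro g
      have := hc f hf g
      rw [← QuotientGroup.eq_one_iff] at this
      simp only [QuotientGroup.mk_mul, QuotientGroup.mk_inv] at this
      exact (mul_inv_eq_iff_eq_mul.1 (mul_inv_eq_one.1 this)).symm
    have h1 : ((x ^ (-n) : G) : G ⧸ N) * (y : G ⧸ N) = (f : G ⧸ N) * y * ((x ^ (-n) : G) : G ⧸ N) := by
      rw [← QuotientGroup.mk_mul, ← QuotientGroup.mk_mul, ← QuotientGroup.mk_mul, hfd]
      congr 1
      group
    have hfp : (f : G ⧸ N) ^ p = 1 := by
      rw [← QuotientGroup.mk_pow, QuotientGroup.eq_one_iff]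
      exact hN.pow f hf
    have h2 := mul_pow_class_two h1 (hfc _) (hfc _) p
    rw [pow_choose_two hodd hfp, one_mul] at h2
    rw [← QuotientGroup.eq_one_iff, QuotientGroup.mk_pow, QuotientGroup.mk_mul, h2,
      ← QuotientGroup.mk_pow, hn, ← QuotientGroup.mk_pow, ← QuotientGroup.mk_mul,
      QuotientGroup.eq_one_iff]
    have : c * (x ^ p) ^ n * (x ^ (-n)) ^ p = c := by
      have : (x ^ (-n)) ^ p = ((x ^ p) ^ n)⁻¹ := by
        rw [← zpow_natCast, ← zpow_natCast, ← zpow_mul, ← zpow_mul, ← zpow_neg]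
        congr 1
        ring
      rw [this]; group
    rw [this]
    exact hcN

theorem core {G : Type*} [Group G] [Finite G] {p : ℕ} [hp : Fact p.Prime]
    (hodd : Odd p) (hG : IsPGroup p G) {K M : Subgroup G} (hK : K.Normal) (hstar : MinStar K)
    (hM : MaxIn p M K) (hMn : ∃ a ∈ M, ∃ b ∈ M, a * b ≠ b * a)
    {x y : G} (hx : x ^ p ∈ K) (hy : y ^ p ∈ K) (hxy : x * y * x⁻¹ * y⁻¹ ∈ K)
    (hind : ∀ i j : ℤ, x ^ i * y ^ j ∈ K → (p : ℤ) ∣ i ∧ (p : ℤ) ∣ j) : False := by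
  have hKn : ¬ ∀ a ∈ K, ∀ b ∈ K, a * b = b * a := by
    intro h
    obtain ⟨a, ha, b, hb, hab⟩ := hMn
    exact hab (h a (hM.le ha) b (hM.le hb))
  have hne : K ≠ ⊥ := by
    rintro rfl
    apply hKn
    intro a ha b hb
    rw [Subgroup.mem_bot] at ha hb
    rw [ha, hb]
  have hp1 : ¬ (p : ℤ) ∣ 1 := by
    intro h
    have := Int.natCast_dvd_natCast.1 (by simpa using h : (p : ℤ) ∣ ((1 : ℕ) : ℤ))
    exact hp.out.one_lt.ne' (Nat.dvd_one.1 this)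
  obtain ⟨N, hN, hc⟩ := exists_N hG hK hne
  have hNn : N.Normal := ⟨fun n hn g => by
    have := mul_mem (hc n (hN.le hn) g) hn
    simpa using this⟩
  have hcinv : ∀ k ∈ K, ∀ g, k * g * k⁻¹ * g⁻¹ ∈ N := by
    intro k hk g
    have := inv_mem (hc k hk g)
    convert this using 1
    group
  have hNconj : ∀ g, ∀ n ∈ N, g * n * g⁻¹ ∈ N := fun g n hn => hNn.conj_mem n hn g
  have hNab : ∀ a ∈ N, ∀ b ∈ N, a * b = b * a := by
    obtain ⟨w, hwK, hwp⟩ := exists_w hodd hK hN hc hNn hx hy hxy hind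
    intro a ha b hb
    by_contra hcon
    have hNS : N ≤ N ⊔ Subgroup.zpowers w := le_sup_left
    have := hstar _ (not_le_sup_zpowers hp.out hN.le (hNconj w) hwK hwp hN.ne) a (hNS ha) b
      (hNS hb) hcon N hNS ha hb
    exact hwK (hN.le (this ((le_sup_right : _ ≤ N ⊔ Subgroup.zpowers w)
      (Subgroup.mem_zpowers w))))
  have hcentN : ∀ k ∈ K, (∀ n ∈ N, n * k = k * n) → k ∈ N := by
    intro k hk h
    by_contra hkN
    exact hKn (abel_of_gen hN hNab hk hkN h)
  have hpc : ∀ g, g ∉ K → g ^ p ∈ K → ∀ k ∈ K, k * g ^ p = g ^ p * k := fun g hg hgp =>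
    pow_central hodd hG hK hstar hM hMn hg hgp
  have hpN : ∀ g, g ∉ K → g ^ p ∈ K → g ^ p ∈ N := fun g hg hgp =>
    hcentN _ hgp fun n hn => hpc g hg hgp n (hN.le hn)
  set D := K ⊓ Subgroup.centralizer (K : Set G) with hD
  have hDmem : ∀ d, d ∈ D ↔ d ∈ K ∧ ∀ k ∈ K, k * d = d * k := by
    intro d
    rw [hD, Subgroup.mem_inf, Subgroup.mem_centralizer_iff]
    rfl
  have hDN : D ≤ N := fun d hd => by
    obtain ⟨h1, h2⟩ := (hDmem d).1 hd
    exact hcentN d h1 fun n hn => h2 n (hN.le hn)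
  have hND : ¬ N ≤ D := by
    intro h
    obtain ⟨k, hk, hkN⟩ := hN.ne
    exact hkN (hcentN k hk fun n hn => (((hDmem n).1 (h hn)).2 k hk).symm)
  have hDconj : ∀ g, ∀ d ∈ D, g * d * g⁻¹ ∈ D := by
    intro g d hd
    obtain ⟨h1, h2⟩ := (hDmem d).1 hd
    refine (hDmem _).2 ⟨hK.conj_mem d h1 g, fun k hk => ?_⟩
    have := h2 (g⁻¹ * k * g) (by simpa using hK.conj_mem k hk g⁻¹)
    calc k * (g * d * g⁻¹) = g * ((g⁻¹ * k * g) * d) * g⁻¹ := by group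
      _ = g * d * g⁻¹ * k := by rw [this]; group
  have h4 : ∀ g, g ∉ K → g ^ p ∈ K → ∀ d ∈ D, g * d = d * g := by
    intro g hg hgp d hd
    by_contra hcon
    have hgT : g ∈ D ⊔ Subgroup.zpowers g :=
      (le_sup_right : _ ≤ D ⊔ Subgroup.zpowers g) (Subgroup.mem_zpowers g)
    have hTS : D ⊔ Subgroup.zpowers g ≤ N ⊔ Subgroup.zpowers g := sup_le_sup_right hDN _
    have hdT : d ∈ D ⊔ Subgroup.zpowers g := (le_sup_left : D ≤ _) hd
    have := hstar _ (not_le_sup_zpowers hp.out hN.le (hNconj g) hg (hpN g hg hgp) hN.ne)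
      g (hTS hgT) d (hTS hdT) hcon _ hTS hgT hdT
    apply hND
    intro n hn
    exact inf_sup_zpowers (K := K) hp.out (hDN.trans hN.le) (hDconj g) hg
      ((hDmem _).2 ⟨hgp, hpc g hg hgp⟩) (this ((le_sup_left : N ≤ _) hn)) (hN.le hn)
  have h5 : ∀ g, g ∉ K → g ^ p ∈ K → ∀ n ∈ N, n * g * n⁻¹ * g⁻¹ ∈ D := by
    intro g hg hgp n hn
    obtain ⟨-, h2⟩ := comm_props hG hNab (g := g) (hNconj g)
      (hstar _ (not_le_sup_zpowers hp.out hN.le (hNconj g) hg (hpN g hg hgp) hN.ne)) n hn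
    exact (hDmem _).2 ⟨hN.le (hcinv n (hN.le hn) g),
      fun k hk => h2 k (hNconj k) (hcinv k hk g)⟩
  have hxK : x ∉ K := fun h => hp1 (hind 1 0 (by simpa using h)).1
  have hyK : y ∉ K := fun h => hp1 (hind 0 1 (by simpa using h)).2
  by_cases hxyN : x * y * x⁻¹ * y⁻¹ ∈ N
  · -- case 7
    have key : ∀ x', x' ^ p ∈ K → x' * y * x'⁻¹ * y⁻¹ ∈ N →
        (∀ i j : ℤ, x' ^ i * y ^ j ∈ K → (p : ℤ) ∣ i ∧ (p : ℤ) ∣ j) →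
        ∀ n ∈ N, n * x' = x' * n := by
      intro x' hx' hxy' hind' n hn
      have hxK' : x' ∉ K := fun h => hp1 (hind' 1 0 (by simpa using h)).1
      by_contra hcon
      set T := N ⊔ Subgroup.zpowers x' with hT
      have hNT : N ≤ T := le_sup_left
      have hxT : x' ∈ T := (le_sup_right : _ ≤ T) (Subgroup.mem_zpowers x')
      have hyT : ∀ t ∈ T, y * t * y⁻¹ ∈ T := by
        intro t ht
        have : T ≤ T.comap (MulAut.conj y).toMonoidHom := by
          conv_lhs => rw [hT]
          refine sup_le ?_ ?_
          · intro a ha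
            change y * a * y⁻¹ ∈ T
            exact hNT (hNconj y a ha)
          · rw [Subgroup.zpowers_le]
            change y * x' * y⁻¹ ∈ T
            have := mul_mem (hNT (inv_mem hxy')) hxT
            convert this using 1
            group
        exact this ht
      have hTS : T ≤ T ⊔ Subgroup.zpowers y := le_sup_left
      have hyS : y ∈ T ⊔ Subgroup.zpowers y :=
        (le_sup_right : _ ≤ T ⊔ Subgroup.zpowers y) (Subgroup.mem_zpowers y)
      have hKS : ¬ K ≤ T ⊔ Subgroup.zpowers y := by
        intro h
        obtain ⟨k, hk, hkN⟩ := hN.ne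
        apply hkN
        obtain ⟨t, ht, j, rfl⟩ := mem_sup_zpowers hyT (h hk)
        obtain ⟨m, hm, i, rfl⟩ := mem_sup_zpowers (hNconj x') ht
        rw [mul_assoc] at hk ⊢
        have h1 := (K.mul_mem_cancel_left (hN.le hm)).1 hk
        obtain ⟨⟨i', rfl⟩, ⟨j', rfl⟩⟩ := hind' _ _ h1
        refine mul_mem hm (mul_mem ?_ ?_)
        · rw [zpow_mul, zpow_natCast]
          exact zpow_mem (hpN _ hxK' hx') _
        · rw [zpow_mul, zpow_natCast]
          exact zpow_mem (hpN _ hyK hy) _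
      have := hstar _ hKS n (hTS (hNT hn)) x' (hTS hxT) hcon T hTS (hNT hn) hxT hyS
      obtain ⟨m, hm, i, hi⟩ := mem_sup_zpowers (hNconj x') this
      have h1 : x' ^ i * y ^ (-1 : ℤ) ∈ K := by
        have : x' ^ i * y ^ (-1 : ℤ) = m⁻¹ := by rw [hi]; group
        rw [this]
        exact inv_mem (hN.le hm)
      exact hp1 (by simpa using (hind' _ _ h1).2)
    obtain ⟨k, hk, hkN⟩ := hN.ne
    have hkq : (k : G ⧸ K) = 1 := (QuotientGroup.eq_one_iff k).2 hk
    apply hkN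
    apply hcentN k hk
    intro n hn
    have e1 : Commute n x := key x hx hxyN hind n hn
    have e2 : Commute n (x * k) := by
      refine key (x * k) ?_ ?_ ?_ n hn
      · rw [← QuotientGroup.eq_one_iff] at hx ⊢
        rw [QuotientGroup.mk_pow] at hx ⊢
        rw [QuotientGroup.mk_mul, hkq, mul_one, hx]
      · have := mul_mem (hNconj x _ (hcinv k hk y)) hxyN
        convert this using 1
        group
      · intro i j h
        apply hind i j
        rw [← QuotientGroup.eq_one_iff] at h ⊢
        simpa [hkq] using h
    have e3 : Commute n (x⁻¹ * (x * k)) := e1.inv_right.mul_right e2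
    rw [inv_mul_cancel_left] at e3
    exact e3.eq
  · -- case 6
    apply hxyN
    apply hcentN _ hxy
    intro n hn
    have z1 := h5 x hxK hx n hn
    have z2 := h5 y hyK hy n hn
    set u := n * x * n⁻¹ * x⁻¹ with hu
    set v := n * y * n⁻¹ * y⁻¹ with hv
    have ux : Commute x u := h4 x hxK hx u z1
    have uy : Commute y u := h4 y hyK hy u z1
    have vx : Commute x v := h4 x hxK hx v z2
    have vy : Commute y v := h4 y hyK hy v z2
    have uv : Commute u v := hNab _ (hDN z1) _ (hDN z2)
    have n1 : n * x * n⁻¹ = u * x := by rw [hu]; group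
    have n2 : n * y * n⁻¹ = v * y := by rw [hv]; group
    have : n * (x * y * x⁻¹ * y⁻¹) * n⁻¹ = x * y * x⁻¹ * y⁻¹ := by
      calc n * (x * y * x⁻¹ * y⁻¹) * n⁻¹
          = (n * x * n⁻¹) * (n * y * n⁻¹) * (n * x * n⁻¹)⁻¹ * (n * y * n⁻¹)⁻¹ := by group
        _ = (u * x) * (v * y) * (u * x)⁻¹ * (v * y)⁻¹ := by rw [n1, n2]
        _ = u * (x * v) * y * x⁻¹ * (u⁻¹ * y⁻¹) * v⁻¹ := by group
        _ = u * v * (x * y * x⁻¹ * y⁻¹) * (u⁻¹ * v⁻¹) := by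
            rw [vx.eq, uy.inv_inv.eq.symm]; group
        _ = (x * y * x⁻¹ * y⁻¹) * (u * v) * (u⁻¹ * v⁻¹) := by
            have c1 : Commute (u * v) x := (ux.mul_right vx).symm
            have c2 : Commute (u * v) y := (uy.mul_right vy).symm
            have : Commute (u * v) (x * y * x⁻¹ * y⁻¹) :=
              ((c1.mul_right c2).mul_right c1.inv_right).mul_right c2.inv_right
            rw [this.eq]
        _ = _ := by rw [uv.eq]; group
    exact mul_inv_eq_iff_eq_mul.1 this

lemma isA_sub {G : Type*} [Group G] {p : ℕ} (S : Subgroup G) :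
    IsAGroup p 2 ↥S ↔ (∃ C ≤ S, C.relIndex S = p ∧ ∃ a ∈ C, ∃ b ∈ C, a * b ≠ b * a) ∧
      ∀ C ≤ S, C.relIndex S = p ^ 2 → ∀ a ∈ C, ∀ b ∈ C, a * b = b * a := by
  have hmap : ∀ H : Subgroup S, (H.map S.subtype).relIndex S = H.index := by
    intro H
    rw [Subgroup.relIndex, Subgroup.subgroupOf,
      Subgroup.comap_map_eq_self_of_injective S.subtype_injective]
  constructor
  · rintro ⟨⟨H, hi, hn⟩, h2⟩
    refine ⟨⟨H.map S.subtype, Subgroup.map_subtype_le H, by rw [hmap, hi]; simp, ?_⟩, ?_⟩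
    · push Not at hn
      obtain ⟨a, ha, b, hb, hab⟩ := hn
      exact ⟨a, ⟨a, ha, rfl⟩, b, ⟨b, hb, rfl⟩, fun h => hab (Subtype.ext h)⟩
    · intro C hC hi a ha b hb
      have := h2 (C.subgroupOf S) hi ⟨a, hC ha⟩ (Subgroup.mem_subgroupOf.2 ha) ⟨b, hC hb⟩
        (Subgroup.mem_subgroupOf.2 hb)
      exact congrArg Subtype.val this
  · rintro ⟨⟨C, hC, hi, a, ha, b, hb, hab⟩, h2⟩
    refine ⟨⟨C.subgroupOf S, hi.trans (by simp), ?_⟩, ?_⟩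
    · intro h
      exact hab (congrArg Subtype.val (h ⟨a, hC ha⟩ (Subgroup.mem_subgroupOf.2 ha) ⟨b, hC hb⟩
        (Subgroup.mem_subgroupOf.2 hb)))
    · intro H hi a ha b hb
      exact Subtype.ext (h2 (H.map S.subtype) (Subgroup.map_subtype_le H) (by rw [hmap, hi])
        a ⟨a, ha, rfl⟩ b ⟨b, hb, rfl⟩)

lemma isA_equiv {G H : Type*} [Group G] [Group H] {p t : ℕ} (e : G ≃* H)
    (h : IsAGroup p t G) : IsAGroup p t H := by
  obtain ⟨⟨C, hi, hn⟩, h2⟩ := h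
  refine ⟨⟨C.map (e : G →* H), by rw [Subgroup.index_map_equiv, hi], ?_⟩, ?_⟩
  · intro h
    apply hn
    intro a ha b hb
    apply e.injective
    rw [map_mul, map_mul]
    exact h (e a) ⟨a, ha, rfl⟩ (e b) ⟨b, hb, rfl⟩
  · intro J hJ a ha b hb
    have hi' : (J.map (e.symm : H →* G)).index = p ^ t := by
      rw [Subgroup.index_map_equiv, hJ]
    apply e.symm.injective
    rw [map_mul, map_mul]
    exact h2 _ hi' _ ⟨a, ha, rfl⟩ _ ⟨b, hb, rfl⟩

lemma exists_A2 {G : Type*} [Group G] [Finite G] {p : ℕ} [hp : Fact p.Prime]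
    (hG : IsPGroup p G) :
    ∀ (n : ℕ) (S : Subgroup G), Nat.card S = n →
      (∃ T < S, ∃ a ∈ T, ∃ b ∈ T, a * b ≠ b * a) → ∃ K ≤ S, IsAGroup p 2 ↥K := by
  intro n
  induction n using Nat.strong_induction_on with
  | _ n ih =>
  intro S hSn ⟨T, hT, a, ha, b, hb, hab⟩
  obtain ⟨C, hTC, hC, hm⟩ := exists_maxIn hG hT
  by_cases h2 : ∀ C ≤ S, C.relIndex S = p ^ 2 → ∀ a ∈ C, ∀ b ∈ C, a * b = b * a
  · exact ⟨S, le_rfl, (isA_sub S).2 ⟨⟨C, hm.le, hC, a, hTC ha, b, hTC hb, hab⟩, h2⟩⟩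
  push Not at h2
  obtain ⟨J, hJS, hJ, a', ha', b', hb', hab'⟩ := h2
  have hlt : J < S := by
    refine lt_of_le_of_ne hJS ?_
    rintro rfl
    rw [Subgroup.relIndex_self] at hJ
    exact (Nat.one_lt_pow two_ne_zero hp.out.one_lt).ne hJ
  obtain ⟨B, hJB, hB, hmB⟩ := exists_maxIn hG hlt
  have hJB' : J < B := by
    refine lt_of_le_of_ne hJB ?_
    rintro rfl
    rw [hB] at hJ
    have := hp.out.one_lt
    nlinarith
  have hBS : B ≠ S := by
    rintro rfl
    rw [Subgroup.relIndex_self] at hB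
    exact hp.out.one_lt.ne hB
  obtain ⟨K, hK, hKA⟩ := ih (Nat.card B) (by
    rw [← hSn]
    refine lt_of_le_of_ne (Subgroup.card_le_of_le hmB.le) ?_
    intro h
    exact hBS (Subgroup.eq_of_le_of_card_ge hmB.le h.ge)) B rfl ⟨J, hJB', a', ha', b', hb', hab'⟩
  exact ⟨K, hK.trans hmB.le, hKA⟩

theorem stmt16 {p : ℕ} (hp : p.Prime) (hodd : Odd p) :
    ∀ (G : Type) (_ : Group G) (_ : Finite G), IsPGroup p G →
      p ^ 2 ≤ Nat.card (commutator G) →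
      ¬ ∃ K : Subgroup G, IsAGroup p 2 ↥K ∧
          (∀ K' : Subgroup G, IsAGroup p 2 ↥K' → K' = K) ∧ K ≤ frattini G := by
  rintro G _ _ hG - ⟨K, hKA, huniq, hfr⟩
  haveI : Fact p.Prime := ⟨hp⟩
  have hK : K.Normal := by
    refine ⟨fun k hk g => ?_⟩
    have h1 := huniq (K.map (MulAut.conj g).toMonoidHom)
      (isA_equiv (K.equivMapOfInjective _ (MulAut.conj g).injective) hKA)
    rw [← h1]
    exact ⟨k, hk, rfl⟩
  have hstar : MinStar K := by
    intro S hKS a ha b hb hab T hTS haT hbT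
    by_contra hcon
    obtain ⟨K', hK'S, hK'⟩ := exists_A2 hG _ S rfl
      ⟨T, lt_of_le_not_ge hTS hcon, a, haT, b, hbT, hab⟩
    exact hKS (huniq K' hK' ▸ hK'S)
  obtain ⟨⟨M, hMK, hMi, hMn⟩, -⟩ := (isA_sub K).1 hKA
  have hM := maxIn_of_relIndex hG hMK hMi
  have hcyc : ∀ g : G ⧸ K, (⊤ : Subgroup (G ⧸ K)) ≠ Subgroup.zpowers g := by
    intro g hg
    obtain ⟨g, rfl⟩ := QuotientGroup.mk_surjective g
    have h1 : Subgroup.zpowers g ⊔ frattini G = ⊤ := by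
      rw [eq_top_iff]
      intro t _
      have ht : (t : G ⧸ K) ∈ Subgroup.zpowers (g : G ⧸ K) := hg ▸ Subgroup.mem_top _
      obtain ⟨i, hi⟩ := ht
      have hi' : ((g ^ i : G) : G ⧸ K) = t := hi
      rw [QuotientGroup.eq] at hi'
      have : t = g ^ i * ((g ^ i)⁻¹ * t) := by group
      rw [this]
      exact mul_mem ((le_sup_left : Subgroup.zpowers g ≤ _)
        (zpow_mem (Subgroup.mem_zpowers g) i)) ((le_sup_right : frattini G ≤ _) (hfr hi'))
    have h2 := frattini_nongenerating h1
    obtain ⟨a, -, b, -, hab⟩ := hMn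
    apply hab
    obtain ⟨i, rfl⟩ : a ∈ Subgroup.zpowers g := h2 ▸ Subgroup.mem_top a
    obtain ⟨j, rfl⟩ : b ∈ Subgroup.zpowers g := h2 ▸ Subgroup.mem_top b
    exact ((Commute.refl g).zpow_zpow i j).eq
  obtain ⟨x, y, hxy, hx, hy, hind⟩ := exists_rank_two hodd (hG.to_quotient K) _ ⊤ rfl hcyc
  obtain ⟨x, rfl⟩ := QuotientGroup.mk_surjective x
  obtain ⟨y, rfl⟩ := QuotientGroup.mk_surjective y
  refine core hodd hG hK hstar hM hMn (x := x) (y := y) ?_ ?_ ?_ ?_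
  · rw [← QuotientGroup.eq_one_iff]; exact hx
  · rw [← QuotientGroup.eq_one_iff]; exact hy
  · rw [← QuotientGroup.eq_one_iff]
    simp only [QuotientGroup.mk_mul, QuotientGroup.mk_inv]
    rw [hxy]
    group
  · intro i j h
    apply hind i j
    rw [← QuotientGroup.eq_one_iff] at h
    exact h
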